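/- A factor of a Sturmian word has exactly two abelian returns if and only if it is singular, i.e., it is the unique factor in its abelian equivalence class. -/

import Mathlib

/-- The factor of length `n` of the infinite word `w` starting at position `i`. -/
def wordAt {α : Type*} (w : ℕ → α) (i n : ℕ) : List α :=
  (List.range n).map (fun k => w (i + k))

/-- `u` is a factor of the infinite word `w`. -/
def IsFactorW {α : Type*} (w : ℕ → α) (u : List α) : Prop :=
  ∃ i, u = wordAt w i u.length

/-- `w` is recurrent: every factor occurs infinitely often. -/
def RecurrentW {α : Type*} (w : ℕ → α) : Prop :=
  ∀ u, IsFactorW w u → ∀ N, ∃ i, N ≤ i ∧ u = wordAt w i u.length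

/-- `w` is (purely) periodic. -/
def PeriodicW {α : Type*} (w : ℕ → α) : Prop :=
  ∃ T, 0 < T ∧ ∀ n, w (n + T) = w n

/-- `w` is ultimately periodic. -/
def UltPeriodicW {α : Type*} (w : ℕ → α) : Prop :=
  ∃ T, 0 < T ∧ ∃ n₀, ∀ n, n₀ ≤ n → w (n + T) = w n

/-- Two finite words are abelian equivalent: same number of occurrences of each letter. -/
def AbEquiv {α : Type*} [DecidableEq α] (u v : List α) : Prop :=
  ∀ a : α, u.count a = v.count a

/-- Positions of occurrences of words abelian equivalent to `u` in `w`. -/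
def abOcc {α : Type*} [DecidableEq α] (w : ℕ → α) (u : List α) : Set ℕ :=
  {i | AbEquiv (wordAt w i u.length) u}

/-- The semi-abelian returns to (the abelian class of) `u` in `w`: words extending from one
occurrence of the abelian class of `u` to the next one. -/
def semiAbReturns {α : Type*} [DecidableEq α] (w : ℕ → α) (u : List α) : Set (List α) :=
  {r | ∃ i j, i ∈ abOcc w u ∧ j ∈ abOcc w u ∧ i < j ∧
      (∀ k, i < k → k < j → k ∉ abOcc w u) ∧ r = wordAt w i (j - i)}

/-- Positions of (exact) occurrences of `u` in `w`. -/
def occW {α : Type*} [DecidableEq α] (w : ℕ → α) (u : List α) : Set ℕ :=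
  {i | u = wordAt w i u.length}

/-- The ordinary return words of `u` in `w`. -/
def returnWords {α : Type*} [DecidableEq α] (w : ℕ → α) (u : List α) : Set (List α) :=
  {r | ∃ i j, i ∈ occW w u ∧ j ∈ occW w u ∧ i < j ∧
      (∀ k, i < k → k < j → k ∉ occW w u) ∧ r = wordAt w i (j - i)}

/-- `u` has exactly `k` semi-abelian returns in `w`. -/
def ExactlyKSemiAbReturns {α : Type*} [DecidableEq α] (w : ℕ → α) (u : List α) (k : ℕ) : Prop :=
  ∃ f : Fin k → List α, Function.Injective f ∧ semiAbReturns w u = Set.range f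

/-- `u` has exactly `k` abelian returns in `w`: there are `k` pairwise non-abelian-equivalent
representatives so that every semi-abelian return is abelian equivalent to exactly one of them,
and each representative is realized. -/
def ExactlyKAbReturns {α : Type*} [DecidableEq α] (w : ℕ → α) (u : List α) (k : ℕ) : Prop :=
  ∃ f : Fin k → List α,
    (∀ i j, AbEquiv (f i) (f j) → i = j) ∧
    (∀ r ∈ semiAbReturns w u, ∃ i, AbEquiv r (f i)) ∧
    (∀ i, ∃ r ∈ semiAbReturns w u, AbEquiv r (f i))

/-- `u` has at most `k` abelian returns in `w`. -/
def AtMostKAbReturns {α : Type*} [DecidableEq α] (w : ℕ → α) (u : List α) (k : ℕ) : Prop :=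
  ∃ f : Fin k → List α, ∀ r ∈ semiAbReturns w u, ∃ i, AbEquiv r (f i)

/-- `u` has at least `k` abelian returns in `w`. -/
def AtLeastKAbReturns {α : Type*} [DecidableEq α] (w : ℕ → α) (u : List α) (k : ℕ) : Prop :=
  ∃ f : Fin k → List α,
    (∀ i j, AbEquiv (f i) (f j) → i = j) ∧
    (∀ i, ∃ r ∈ semiAbReturns w u, AbEquiv r (f i))

/-- `u` has at least two semi-abelian returns in `w`. -/
def AtLeastTwoSemiAbReturns {α : Type*} [DecidableEq α] (w : ℕ → α) (u : List α) : Prop :=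
  ∃ r₁ r₂, r₁ ∈ semiAbReturns w u ∧ r₂ ∈ semiAbReturns w u ∧ r₁ ≠ r₂

/-- The factor complexity of `w`. -/
noncomputable def complexityW {α : Type*} (w : ℕ → α) (n : ℕ) : ℕ :=
  {u : List α | u.length = n ∧ IsFactorW w u}.ncard

/-- A Sturmian word: aperiodic binary word with factor complexity `n + 1`. -/
def SturmianW (w : ℕ → Bool) : Prop :=
  ¬ UltPeriodicW w ∧ ∀ n, complexityW w n = n + 1

/-- Right special factor of a binary word. -/
def RightSpecial (w : ℕ → Bool) (B : List Bool) : Prop :=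
  IsFactorW w (B ++ [false]) ∧ IsFactorW w (B ++ [true])

/-- Left special factor of a binary word. -/
def LeftSpecial (w : ℕ → Bool) (B : List Bool) : Prop :=
  IsFactorW w (false :: B) ∧ IsFactorW w (true :: B)

/-- Bispecial factor of a binary word. -/
def Bispecial (w : ℕ → Bool) (B : List Bool) : Prop :=
  RightSpecial w B ∧ LeftSpecial w B

/-- `w` is `c`-balanced. -/
def CBalanced {α : Type*} [DecidableEq α] (w : ℕ → α) (c : ℕ) : Prop :=
  ∀ u v : List α, IsFactorW w u → IsFactorW w v → u.length = v.length →
    ∀ a : α, |((u.count a : ℤ) - (v.count a : ℤ))| ≤ (c : ℤ)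

theorem Irrational.exists_sub_mul_small {α : ℝ} (hα : Irrational α) (N : ℕ) {ε : ℝ} (hε : 0 < ε) :
    ∃ k : ℕ, N ≤ k ∧ ∃ m : ℤ, 0 < m - k * α ∧ m - k * α < ε := by
  have hne : ∀ (k : ℕ) (m : ℤ), 0 < k → (m : ℝ) - k * α ≠ 0 := fun k m hk h =>
    (hα.natCast_mul hk.ne').ne_int m (by linarith)
  have hmin : 0 < min ε 1 := lt_min hε one_pos
  obtain ⟨n, hn⟩ := exists_nat_one_div_lt (div_pos hmin (Nat.cast_add_one_pos (α := ℝ) N))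
  obtain ⟨k, hk0, -, hk⟩ := Real.exists_nat_abs_mul_sub_round_le α (Nat.succ_pos n)
  have hlt : |(k : ℝ) * α - round ((k : ℝ) * α)| < min ε 1 / (N + 1) := by
    refine (hk.trans ?_).trans_lt hn
    apply one_div_le_one_div_of_le (by positivity)
    push_cast; linarith
  set m : ℤ := round ((k : ℝ) * α)
  rw [lt_div_iff₀ (by positivity)] at hlt
  have hN : (0 : ℝ) < N + 1 := by positivity
  have hN' : N ≤ (N + 1) * k := by nlinarith
  have habs : |((N + 1 : ℕ) * k : ℕ) * α - ((N + 1 : ℤ) * m : ℤ)| < min ε 1 := by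
    have : (((N + 1 : ℕ) * k : ℕ) : ℝ) * α - ((N + 1 : ℤ) * m : ℤ) = (N + 1) * (k * α - m) := by
      push_cast; ring
    rwa [this, abs_mul, abs_of_pos hN, mul_comm]
  have hne' := hne ((N + 1) * k) ((N + 1) * m) (by positivity)
  generalize (N + 1) * k = k' at *
  generalize ((N : ℤ) + 1) * m = m' at *
  obtain ⟨h1, h2⟩ := abs_lt.1 habs
  have hε' := min_le_left ε 1
  have hone := min_le_right ε 1
  rcases hne'.lt_or_gt with h | h
  · set η := (k' : ℝ) * α - m' with hη
    have hη0 : 0 < η := by linarith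
    have hM := Nat.floor_le (one_div_pos.2 hη0).le
    have hM' := Nat.lt_floor_add_one (1 / η)
    have hM1 : 1 ≤ ⌊1 / η⌋₊ := by
      rw [Nat.one_le_floor_iff, le_div_iff₀ hη0]; linarith
    rw [le_div_iff₀ hη0] at hM
    rw [div_lt_iff₀ hη0] at hM'
    generalize ⌊1 / η⌋₊ = M at *
    have hk' : 0 < k' := by
      rcases Nat.eq_zero_or_pos k' with rfl | h
      · have h3 : (m' : ℝ) ≤ -1 := by
          have : m' ≤ -1 := by
            have : (m' : ℝ) < 0 := by simpa using h
            have : m' < 0 := by exact_mod_cast this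
            omega
          exact_mod_cast this
        simp [hη] at h2
        linarith
      · exact h
    refine ⟨M * k', by nlinarith, 1 + M * m', ?_, ?_⟩
    · refine lt_of_le_of_ne ?_ (hne (M * k') (1 + M * m') (by positivity)).symm
      push_cast
      have : (1 + M * m' : ℝ) - M * k' * α = 1 - M * η := by rw [hη]; ring
      linarith
    · push_cast
      have : (1 + M * m' : ℝ) - M * k' * α = 1 - M * η := by rw [hη]; ring
      linarith
  · exact ⟨k', hN', m', h, by linarith⟩

theorem Irrational.exists_sub_mul_mem_Ioo {α : ℝ} (hα : Irrational α) (N : ℕ) {x y : ℝ}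
    (hxy : x < y) : ∃ k : ℕ, N ≤ k ∧ ∃ m : ℤ, x < m - k * α ∧ m - k * α < y := by
  obtain ⟨k, hk, m, h0, hlt⟩ := hα.exists_sub_mul_small N (sub_pos.2 hxy)
  set δ := (m : ℝ) - k * α with hδ
  obtain ⟨Z, hZ⟩ := exists_nat_gt (-x)
  have hpos : 0 ≤ (x + Z) / δ := div_nonneg (by linarith) h0.le
  have h1 := Nat.floor_le hpos
  have h2 := Nat.lt_floor_add_one ((x + Z) / δ)
  rw [le_div_iff₀ h0] at h1
  rw [div_lt_iff₀ h0] at h2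
  generalize ⌊(x + Z) / δ⌋₊ = j at *
  have : (((j + 1 : ℕ) * m - Z : ℤ) : ℝ) - ((j + 1) * k : ℕ) * α = (j + 1) * δ - Z := by
    push_cast; rw [hδ]; ring
  exact ⟨(j + 1) * k, by nlinarith, (j + 1 : ℕ) * m - Z, by rw [this]; linarith,
    by rw [this]; linarith⟩

/-- `θ` is an orbit of the rotation by `-α` on the circle `[ρ, ρ + 1]`, and `X` is the set of times
spent in the arc `[ρ, ρ + L]`, where `L` is congruent to `n * α` modulo one. -/
structure RotationArc (θ : ℕ → ℝ) (α ρ L : ℝ) (n : ℕ) (X : Set ℕ) : Prop where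
  irr : Irrational α
  lower : ∀ i, ρ ≤ θ i
  upper : ∀ i, θ i ≤ ρ + 1
  step : ∀ i k, ∃ m : ℤ, θ (i + k) = θ i + (m - k * α)
  pos : 0 < L
  lt_one : L < 1
  length_eq : ∃ m : ℤ, L = n * α - m
  mem : ∀ i ∈ X, θ (i + n) = θ i + 1 - L
  notMem : ∀ i, i ∉ X → θ (i + n) = θ i - L

/-- Pairs formed by a first return time to `X` and the corresponding displacement of `θ`. -/
def firstReturns (θ : ℕ → ℝ) (X : Set ℕ) : Set (ℕ × ℝ) :=
  {x | ∃ i j, i ∈ X ∧ j ∈ X ∧ i < j ∧ (∀ k, i < k → k < j → k ∉ X) ∧ x = (j - i, θ j - θ i)}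

namespace RotationArc

variable {θ : ℕ → ℝ} {α ρ L : ℝ} {n : ℕ} {X : Set ℕ}

theorem int_sub_mul_ne_zero (h : RotationArc θ α ρ L n X) {k : ℕ} (m : ℤ) (hk : 0 < k) :
    (m : ℝ) - k * α ≠ 0 := fun h0 =>
  (h.irr.natCast_mul hk.ne').ne_int m (by linarith)

theorem ne_of_lt (h : RotationArc θ α ρ L n X) {i j : ℕ} (hij : i < j) : θ i ≠ θ j := by
  obtain ⟨k, rfl⟩ := Nat.exists_eq_add_of_lt hij
  obtain ⟨m, hm⟩ := h.step i (k + 1)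
  have := h.int_sub_mul_ne_zero m (Nat.succ_pos k)
  intro h0
  rw [add_assoc] at h0
  exact this (by linarith)

theorem le_of_mem (h : RotationArc θ α ρ L n X) {i : ℕ} (hi : i ∈ X) : θ i ≤ ρ + L := by
  linarith [h.mem i hi, h.upper (i + n)]

theorem le_of_notMem (h : RotationArc θ α ρ L n X) {i : ℕ} (hi : i ∉ X) : ρ + L ≤ θ i := by
  linarith [h.notMem i hi, h.lower (i + n)]

theorem mem_of_lt (h : RotationArc θ α ρ L n X) {i : ℕ} (hi : θ i < ρ + L) : i ∈ X := by
  by_contra hX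
  linarith [h.le_of_notMem hX]

theorem mem_of_lt_mem (h : RotationArc θ α ρ L n X) {i j : ℕ} (hi : i ∈ X) (hj : θ j < θ i) :
    j ∈ X :=
  h.mem_of_lt (hj.trans_le (h.le_of_mem hi))

/-- A displacement which keeps the orbit strictly inside the fundamental domain is the actual one. -/
theorem eq_of_mem_Ioo (h : RotationArc θ α ρ L n X) {i k : ℕ} {m : ℤ}
    (h1 : ρ < θ i + (m - k * α)) (h2 : θ i + (m - k * α) < ρ + 1) :
    θ (i + k) = θ i + (m - k * α) := by
  obtain ⟨m', hm'⟩ := h.step i k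
  have hl := h.lower (i + k)
  have hu := h.upper (i + k)
  have h3 : (m' : ℝ) < m + 1 := by linarith
  have h4 : (m : ℝ) < m' + 1 := by linarith
  have : m' = m := by
    have h3 : m' < m + 1 := by exact_mod_cast h3
    have h4 : m < m' + 1 := by exact_mod_cast h4
    omega
  rw [hm', this]

theorem eq_of_mem_Ioo' (h : RotationArc θ α ρ L n X) {i k : ℕ} {m : ℤ}
    (h1 : ρ < θ (i + k) - (m - k * α)) (h2 : θ (i + k) - (m - k * α) < ρ + 1) :
    θ i = θ (i + k) - (m - k * α) := by
  obtain ⟨m', hm'⟩ := h.step i k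
  have hl := h.lower i
  have hu := h.upper i
  have h3 : (m' : ℝ) < m + 1 := by linarith
  have h4 : (m : ℝ) < m' + 1 := by linarith
  have : m' = m := by
    have h3 : m' < m + 1 := by exact_mod_cast h3
    have h4 : m < m' + 1 := by exact_mod_cast h4
    omega
  rw [hm', this]; ring

theorem exists_mem_Ioo (h : RotationArc θ α ρ L n X) (N : ℕ) {x y : ℝ} (hx : ρ ≤ x) (hy : y ≤ ρ + 1)
    (hxy : x < y) : ∃ j, N ≤ j ∧ x < θ j ∧ θ j < y := by
  obtain ⟨k, hk, m, h1, h2⟩ := h.irr.exists_sub_mul_mem_Ioo N (sub_lt_sub_right hxy (θ 0))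
  have := h.eq_of_mem_Ioo (i := 0) (k := k) (m := m) (by linarith) (by linarith)
  exact ⟨0 + k, by omega, by linarith, by linarith⟩

theorem exists_next (h : RotationArc θ α ρ L n X) (i : ℕ) :
    ∃ j ∈ X, i < j ∧ ∀ k, i < k → k < j → k ∉ X := by
  classical
  have hex : ∃ j, j ∈ X ∧ i < j := by
    obtain ⟨j, hj, -, h2⟩ := h.exists_mem_Ioo (i + 1) le_rfl (y := ρ + L)
      (by linarith [h.lt_one]) (by linarith [h.pos])
    exact ⟨j, h.mem_of_lt h2, hj⟩
  exact ⟨Nat.find hex, (Nat.find_spec hex).1, (Nat.find_spec hex).2,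
    fun k hk hk' hX => Nat.find_min hex hk' ⟨hX, hk⟩⟩

/-- Two points of the arc separated within `k` steps force a descending return in time `k`. -/
theorem exists_descent (h : RotationArc θ α ρ L n X) {i j k : ℕ} (hi : i ∈ X) (hj : j ∈ X)
    (hne : θ (i + k) - θ i ≠ θ (j + k) - θ j) :
    ∃ l ∈ X, l + k ∈ X ∧ θ (l + k) < θ l := by
  have hk : 0 < k := by
    rcases Nat.eq_zero_or_pos k with rfl | h
    · simp at hne
    · exact h
  have key : ∀ i j, j ∈ X → θ (j + k) - θ j < θ (i + k) - θ i →
      ∃ l ∈ X, l + k ∈ X ∧ θ (l + k) < θ l := by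
    intro i j hj hlt
    obtain ⟨m, hm⟩ := h.step i k
    obtain ⟨m', hm'⟩ := h.step j k
    have h1 : (m' : ℝ) + 1 ≤ m := by
      have : (m' : ℝ) < m := by linarith
      exact_mod_cast this
    have h2 : θ (j + k) < θ j := by
      refine lt_of_le_of_ne ?_ (h.ne_of_lt (by omega)).symm
      linarith [h.lower i, h.upper (i + k)]
    exact ⟨j, hj, h.mem_of_lt_mem hj h2, h2⟩
  rcases hne.lt_or_gt with h1 | h1
  · exact key j i hi h1
  · exact key i j hj h1

/-- Displacements are constant on the arc up to time `n`. -/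
def Rigid (θ : ℕ → ℝ) (n : ℕ) (X : Set ℕ) : Prop :=
  ∀ i ∈ X, ∀ j ∈ X, ∀ k < n, θ (i + k) - θ i = θ (j + k) - θ j

theorem rigid_of_two_firstReturns (h : RotationArc θ α ρ L n X) {x y : ℕ × ℝ}
    (hxy : firstReturns θ X = {x, y}) : Rigid θ n X := by
  have eq_or_eq : ∀ (z : ℕ × ℝ) (hz : z ∈ firstReturns θ X), z = x ∨ z = y := by
    intro z hz; simpa [hxy] using hz
  have hL := h.pos
  have hL1 := h.lt_one
  have climb : ∀ s : ℝ, s ≠ 0 → (∀ z ∈ firstReturns θ X, 0 ≤ s * z.2) →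
      ∀ t i, i ∈ X → i + t ∈ X → 0 ≤ s * (θ (i + t) - θ i) := by
    intro s hs hall t
    induction t using Nat.strong_induction_on with
    | _ t ih =>
      intro i hi hit
      rcases Nat.eq_zero_or_pos t with rfl | ht
      · simp
      obtain ⟨j, hj, hij, hmin⟩ := h.exists_next i
      have hjt : j ≤ i + t := by
        by_contra hlt
        exact hmin (i + t) (by omega) (by omega) hit
      have h1 := hall _ ⟨i, j, hi, hj, hij, hmin, rfl⟩
      have h2 := ih (i + t - j) (by omega) j hj (by rwa [Nat.add_sub_cancel' hjt])
      rw [Nat.add_sub_cancel' hjt] at h2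
      simp only at h1
      nlinarith
  obtain ⟨i₁, hi₁, hi₁'⟩ : ∃ i ∈ X, θ i < ρ + L := by
    obtain ⟨i, -, -, hi⟩ := h.exists_mem_Ioo 0 le_rfl (y := ρ + L) (by linarith) (by linarith)
    exact ⟨i, h.mem_of_lt hi, hi⟩
  have hasc : ∃ z ∈ firstReturns θ X, 0 < z.2 := by
    by_contra! hcon
    obtain ⟨j, hj, h1, h2⟩ := h.exists_mem_Ioo i₁ (h.lower i₁) (y := ρ + L) (by linarith) hi₁'
    have := climb (-1) (by norm_num) (fun z hz => by linarith [hcon z hz]) (j - i₁) i₁ hi₁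
    rw [Nat.add_sub_cancel' hj] at this
    linarith [this (h.mem_of_lt h2)]
  have hdesc : ∃ z ∈ firstReturns θ X, z.2 < 0 := by
    by_contra! hcon
    obtain ⟨i, -, h0, h0'⟩ := h.exists_mem_Ioo 0 le_rfl (y := ρ + L) (by linarith) (by linarith)
    obtain ⟨j, hj, h1, h2⟩ := h.exists_mem_Ioo i le_rfl (y := θ i) (by linarith) h0
    have := climb 1 (by norm_num) (fun z hz => by linarith [hcon z hz]) (j - i) i
      (h.mem_of_lt h0')
    rw [Nat.add_sub_cancel' hj] at this
    linarith [this (h.mem_of_lt (by linarith))]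
  obtain ⟨⟨p, a⟩, hza, ha⟩ := hasc
  obtain ⟨⟨q, b⟩, hzb, hb⟩ := hdesc
  simp only at ha hb
  have hdich : ∀ i ∈ X, ∀ j ∈ X, i < j → (∀ k, i < k → k < j → k ∉ X) →
      (j = i + p ∧ θ j = θ i + a) ∨ (j = i + q ∧ θ j = θ i + b) := by
    intro i hi j hj hij hmin
    have hz : (j - i, θ j - θ i) ∈ firstReturns θ X := ⟨i, j, hi, hj, hij, hmin, rfl⟩
    have hne : ((p, a) : ℕ × ℝ) ≠ (q, b) := fun heq => by
      have := (Prod.mk.inj heq).2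
      linarith
    have : (j - i, θ j - θ i) = (p, a) ∨ (j - i, θ j - θ i) = (q, b) := by
      rcases eq_or_eq _ hz with h1 | h1 <;> rcases eq_or_eq _ hza with h2 | h2 <;>
        rcases eq_or_eq _ hzb with h3 | h3 <;> simp_all
    rcases this with h1 | h1
    · obtain ⟨h2, h3⟩ := Prod.mk.inj h1
      exact Or.inl ⟨by omega, by linarith⟩
    · obtain ⟨h2, h3⟩ := Prod.mk.inj h1
      exact Or.inr ⟨by omega, by linarith⟩
  /- returns in time less than `q` ascend, returns in time less than `p` descend -/
  have asc_of_lt : ∀ t i, i ∈ X → i + t ∈ X → 0 < t → t < q → θ i < θ (i + t) := by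
    intro t
    induction t using Nat.strong_induction_on with
    | _ t ih =>
      intro i hi hit ht htq
      obtain ⟨j, hj, hij, hmin⟩ := h.exists_next i
      have hjt : j ≤ i + t := by
        by_contra hlt
        exact hmin (i + t) (by omega) (by omega) hit
      rcases hdich i hi j hj hij hmin with ⟨h1, h2⟩ | ⟨h1, h2⟩
      · rcases hjt.eq_or_lt with h3 | h3
        · rw [← h3]; linarith
        · have := ih (i + t - j) (by omega) j hj (by rwa [Nat.add_sub_cancel' hjt]) (by omega)
            (by omega)
          rw [Nat.add_sub_cancel' hjt] at this
          linarith
      · omega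
  have desc_of_lt : ∀ t i, i ∈ X → i + t ∈ X → 0 < t → t < p → θ (i + t) < θ i := by
    intro t
    induction t using Nat.strong_induction_on with
    | _ t ih =>
      intro i hi hit ht htq
      obtain ⟨j, hj, hij, hmin⟩ := h.exists_next i
      have hjt : j ≤ i + t := by
        by_contra hlt
        exact hmin (i + t) (by omega) (by omega) hit
      rcases hdich i hi j hj hij hmin with ⟨h1, h2⟩ | ⟨h1, h2⟩
      · omega
      · rcases hjt.eq_or_lt with h3 | h3
        · rw [← h3]; linarith
        · have := ih (i + t - j) (by omega) j hj (by rwa [Nat.add_sub_cancel' hjt]) (by omega)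
            (by omega)
          rw [Nat.add_sub_cancel' hjt] at this
          linarith
  have hp0 : 0 < p := by
    obtain ⟨i, j, -, -, hij, -, h1⟩ := hza
    have := (Prod.mk.inj h1).1
    omega
  have hq0 : 0 < q := by
    obtain ⟨i, j, -, -, hij, -, h1⟩ := hzb
    have := (Prod.mk.inj h1).1
    omega
  obtain ⟨A, hA⟩ : ∃ A : ℤ, a = A - p * α := by
    obtain ⟨i, j, -, -, hij, -, h1⟩ := hza
    obtain ⟨h1, h2⟩ := Prod.mk.inj h1
    obtain ⟨m, hm⟩ := h.step i p
    rw [h1, Nat.add_sub_cancel' hij.le, ← h1] at hm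
    exact ⟨m, by linarith⟩
  obtain ⟨B, hB⟩ : ∃ B : ℤ, b = B - q * α := by
    obtain ⟨i, j, -, -, hij, -, h1⟩ := hzb
    obtain ⟨h1, h2⟩ := Prod.mk.inj h1
    obtain ⟨m, hm⟩ := h.step i q
    rw [h1, Nat.add_sub_cancel' hij.le, ← h1] at hm
    exact ⟨m, by linarith⟩
  have hle : a - b ≤ L := by
    by_contra! hcon
    obtain ⟨i, -, h1, h2⟩ := h.exists_mem_Ioo 0 (x := max ρ (ρ + L - a)) (le_max_left _ _)
      (y := min (ρ + L) (ρ - b)) (by linarith [min_le_left (ρ + L) (ρ - b)])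
      (by rw [max_lt_iff, lt_min_iff, lt_min_iff]
          exact ⟨⟨by linarith, by linarith⟩, by linarith, by linarith⟩)
    rw [max_lt_iff] at h1
    rw [lt_min_iff] at h2
    obtain ⟨j, hj, hij, hmin⟩ := h.exists_next i
    rcases hdich i (h.mem_of_lt h2.1) j hj hij hmin with ⟨-, h3⟩ | ⟨-, h3⟩
    · linarith [h.le_of_mem hj]
    · linarith [h.lower j]
  have hge : L ≤ a - b := by
    by_contra! hcon
    obtain ⟨j, hj, h1, h2⟩ := h.exists_mem_Ioo (p + q) (x := ρ + a) (by linarith)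
      (y := ρ + L + b) (by linarith) (by linarith)
    obtain ⟨i, hi⟩ := Nat.exists_eq_add_of_le' (show p ≤ j by omega)
    obtain ⟨i', hi'⟩ := Nat.exists_eq_add_of_le' (show q ≤ j by omega)
    have e1 : θ i = θ j - a := by
      have := h.eq_of_mem_Ioo' (i := i) (k := p) (m := A) (by rw [← hi, ← hA]; linarith)
        (by rw [← hi, ← hA]; linarith)
      rwa [← hi, ← hA] at this
    have e2 : θ i' = θ j - b := by
      have := h.eq_of_mem_Ioo' (i := i') (k := q) (m := B) (by rw [← hi', ← hB]; linarith)
        (by rw [← hi', ← hB]; linarith)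
      rwa [← hi', ← hB] at this
    have m1 : i ∈ X := h.mem_of_lt (by linarith)
    have m2 : i' ∈ X := h.mem_of_lt (by linarith)
    rcases lt_trichotomy i i' with hlt | heq | hlt
    · have := desc_of_lt (i' - i) i m1 (by rwa [Nat.add_sub_cancel' hlt.le]) (by omega) (by omega)
      rw [Nat.add_sub_cancel' hlt.le] at this
      linarith
    · rw [heq] at e1
      linarith
    · have := asc_of_lt (i - i') i' m2 (by rwa [Nat.add_sub_cancel' hlt.le]) (by omega) (by omega)
      rw [Nat.add_sub_cancel' hlt.le] at this
      linarith
  have hqn : q = n + p := by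
    obtain ⟨m, hm⟩ := h.length_eq
    have hz : ((n + p : ℕ) - (q : ℤ) : ℤ) * α = (m + A - B : ℤ) := by
      push_cast
      linarith
    by_contra hne
    exact (h.irr.intCast_mul (m := (n + p : ℕ) - (q : ℤ)) (by omega)).ne_int _ hz
  intro i hi j hj k hk
  by_contra hne
  obtain ⟨l, hl, hlk, hlt⟩ := h.exists_descent hi hj hne
  have hk0 : 0 < k := by
    rcases Nat.eq_zero_or_pos k with rfl | h
    · simp at hlt
    · exact h
  linarith [asc_of_lt k l hl hlk hk0 (by omega)]

theorem two_firstReturns_of_rigid (h : RotationArc θ α ρ L n X) (hR : Rigid θ n X) :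
    ∃ x y, x ≠ y ∧ firstReturns θ X = {x, y} := by
  classical
  have hL := h.pos
  have hL1 := h.lt_one
  have hdesc : ∃ t, ∃ i ∈ X, i + t ∈ X ∧ θ (i + t) < θ i := by
    obtain ⟨i, -, h0, h0'⟩ := h.exists_mem_Ioo 0 le_rfl (y := ρ + L) (by linarith) (by linarith)
    obtain ⟨j, hj, h1, h2⟩ := h.exists_mem_Ioo i le_rfl (y := θ i) (by linarith) h0
    exact ⟨j - i, i, h.mem_of_lt h0', by rw [Nat.add_sub_cancel' hj]; exact
      ⟨h.mem_of_lt (by linarith), h2⟩⟩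
  have no_short : ∀ k ≤ n, ∀ i ∈ X, i + k ∈ X → θ i ≤ θ (i + k) := by
    intro k hk i hi hik
    rcases hk.eq_or_lt with rfl | hk
    · linarith [h.mem i hi]
    by_contra! hlt
    have iter : ∀ r : ℕ, i + r * k ∈ X ∧ θ (i + r * k) = θ i + r * (θ (i + k) - θ i) := by
      intro r
      induction r with
      | zero => simpa using hi
      | succ r ih =>
        have := hR _ ih.1 i hi k hk
        have e : i + (r + 1) * k = i + r * k + k := by ring
        rw [e]
        exact ⟨h.mem_of_lt_mem ih.1 (by linarith), by push_cast; linarith [ih.2]⟩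
    obtain ⟨r, hr⟩ := exists_nat_gt (1 / (θ i - θ (i + k)))
    rw [div_lt_iff₀ (by linarith)] at hr
    linarith [(iter r).2, h.lower (i + r * k), h.upper i]
  obtain ⟨i₀, hi₀, hq₀, hdown⟩ := Nat.find_spec hdesc
  have no_desc : ∀ k < Nat.find hdesc, ∀ i ∈ X, i + k ∈ X → θ i ≤ θ (i + k) := by
    intro k hk i hi hik
    by_contra! hlt
    exact Nat.find_min hdesc hk ⟨i, hi, hik, hlt⟩
  generalize Nat.find hdesc = q at *
  have hqn : n < q := by
    by_contra! hle
    linarith [no_short q hle i₀ hi₀ hq₀]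
  have const : ∀ k < q, ∀ i ∈ X, ∀ j ∈ X, θ (i + k) - θ i = θ (j + k) - θ j := by
    intro k hk i hi j hj
    by_contra hne
    obtain ⟨l, hl, hlk, hlt⟩ := h.exists_descent hi hj hne
    linarith [no_desc k hk l hl hlk]
  obtain ⟨s, rfl⟩ : ∃ s, q = s + n := ⟨q - n, by omega⟩
  have hn : 0 < n := by
    rcases Nat.eq_zero_or_pos n with rfl | hn
    · have := h.mem i₀ hi₀
      simp only [add_zero] at this
      linarith
    · exact hn
  set c := θ (i₀ + s) - θ i₀ with hc
  have hsX : ∀ i ∈ X, θ (i + s) = θ i + c := fun i hi => by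
    linarith [const s (by omega) i hi i₀ hi₀]
  have hc0 : 0 < c := by
    by_contra! hle
    have hlt : θ (i₀ + s) < θ i₀ :=
      lt_of_le_of_ne (by linarith) (h.ne_of_lt (by omega)).symm
    linarith [no_desc s (by omega) i₀ hi₀ (h.mem_of_lt_mem hi₀ hlt)]
  have hnot : i₀ + s ∉ X := by
    intro hmem
    have := h.mem _ hmem
    rw [add_assoc] at this
    linarith
  have hb : θ (i₀ + (s + n)) = θ i₀ + c - L := by
    have := h.notMem _ hnot
    rw [add_assoc] at this
    linarith
  have hasc : ∃ t, ∃ i ∈ X, i + t ∈ X ∧ θ i < θ (i + t) := by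
    obtain ⟨i, -, -, h2⟩ := h.exists_mem_Ioo 0 le_rfl (y := ρ + L - c) (by linarith)
      (by linarith)
    have hi : i ∈ X := h.mem_of_lt (by linarith)
    have := hsX i hi
    exact ⟨s, i, hi, h.mem_of_lt (by linarith), by linarith⟩
  have hps : Nat.find hasc ≤ s := by
    obtain ⟨i, -, -, h2⟩ := h.exists_mem_Ioo 0 le_rfl (y := ρ + L - c) (by linarith)
      (by linarith)
    have hi : i ∈ X := h.mem_of_lt (by linarith)
    have := hsX i hi
    exact Nat.find_min' hasc ⟨i, hi, h.mem_of_lt (by linarith), by linarith⟩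
  obtain ⟨i₁, hi₁, hp₁, hup⟩ := Nat.find_spec hasc
  have no_asc : ∀ k < Nat.find hasc, ∀ i ∈ X, i + k ∈ X → θ (i + k) ≤ θ i := by
    intro k hk i hi hik
    by_contra! hlt
    exact Nat.find_min hasc hk ⟨i, hi, hik, hlt⟩
  generalize Nat.find hasc = p at *
  set a := θ (i₁ + p) - θ i₁ with ha
  have hpX : ∀ i ∈ X, θ (i + p) = θ i + a := fun i hi => by
    linarith [const p (by omega) i hi i₁ hi₁]
  have lt_imp : ∀ k, p ≤ k → k < s + n → ∀ i ∈ X, θ i + a ≤ θ (i + k) := by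
    intro k hpk hk i hi
    by_contra! hlt
    have h1 := const k hk i hi i₁ hi₁
    have hlt' : θ (i₁ + p + (k - p)) < θ (i₁ + p) := by
      rw [add_assoc, Nat.add_sub_cancel' hpk]
      linarith
    linarith [no_desc (k - p) (by omega) _ hp₁ (h.mem_of_lt_mem hp₁ hlt')]
  have hac : a ≤ c := by
    linarith [lt_imp s hps (by omega) i₀ hi₀]
  have empty_p : ∀ i ∈ X, ∀ k, 0 < k → k < p → i + k ∉ X := by
    intro i hi k hk hkp hik
    exact h.ne_of_lt (show i < i + k by omega)
      (le_antisymm (no_desc k (by omega) i hi hik) (no_asc k hkp i hi hik))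
  have hlong : ∀ i ∈ X, i + p ∉ X →
      (∀ k, 0 < k → k < s + n → i + k ∉ X) ∧ i + (s + n) ∈ X ∧
        θ (i + (s + n)) = θ i + (c - L) := by
    intro i hi hip
    have hup : ∀ k, p ≤ k → k < s + n → i + k ∉ X := by
      intro k hpk hk hik
      have := lt_imp k hpk hk i hi
      rcases this.eq_or_lt with h1 | h1
      · rcases hpk.eq_or_lt with rfl | h2
        · exact hip hik
        · exact h.ne_of_lt (show i + p < i + k by omega) (by linarith [hpX i hi])
      · exact hip (h.mem_of_lt_mem hik (by linarith [hpX i hi]))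
    have hns := h.notMem _ (hup s hps (by omega))
    rw [add_assoc] at hns
    have hd : θ (i + (s + n)) = θ i + (c - L) := by linarith [hsX i hi]
    refine ⟨fun k hk hkq => ?_, h.mem_of_lt_mem hi (by linarith), hd⟩
    rcases lt_or_ge k p with h1 | h1
    · exact empty_p i hi k hk h1
    · exact hup k h1 hkq
  have hp0 : 0 < p := by
    rcases Nat.eq_zero_or_pos p with rfl | h
    · simp at hup
    · exact h
  have hi₀p : i₀ + p ∉ X := by
    intro hmem
    have e : i₀ + p + (s + n - p) = i₀ + (s + n) := by omega
    have := no_desc (s + n - p) (by omega) _ hmem (by rwa [e])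
    rw [e] at this
    linarith [hpX i₀ hi₀]
  refine ⟨(p, a), (s + n, c - L), fun heq => ?_, Set.ext fun z => ⟨?_, ?_⟩⟩
  · have := (Prod.mk.inj heq).2
    linarith
  · rintro ⟨i, j, hi, hj, hij, hmin, rfl⟩
    obtain ⟨k, rfl⟩ := Nat.exists_eq_add_of_lt hij
    by_cases hip : i + p ∈ X
    · left
      have hk : k + 1 = p := by
        rcases lt_trichotomy (k + 1) p with h1 | h1 | h1
        · exact (empty_p i hi (k + 1) (by omega) h1 hj).elim
        · exact h1
        · exact (hmin (i + p) (by omega) (by omega) hip).elim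
      rw [add_assoc, hk, hpX i hi]
      ext <;> simp
    · right
      obtain ⟨h1, h2, h3⟩ := hlong i hi hip
      have hk : k + 1 = s + n := by
        rcases lt_trichotomy (k + 1) (s + n) with h4 | h4 | h4
        · exact (h1 (k + 1) (by omega) h4 hj).elim
        · exact h4
        · exact (hmin (i + (s + n)) (by omega) (by omega) h2).elim
      rw [add_assoc, hk, h3]
      refine Prod.ext ?_ ?_ <;> simp
  · rintro (rfl | rfl)
    · refine ⟨i₁, i₁ + p, hi₁, hp₁, by omega, fun k h1 h2 => ?_, ?_⟩
      · have := empty_p i₁ hi₁ (k - i₁) (by omega) (by omega)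
        rwa [Nat.add_sub_cancel' h1.le] at this
      · simp [ha]
    · obtain ⟨h1, h2, h3⟩ := hlong i₀ hi₀ hi₀p
      refine ⟨i₀, i₀ + (s + n), hi₀, hq₀, by omega, fun k h4 h5 => ?_, ?_⟩
      · have := h1 (k - i₀) (by omega) (by omega)
        rwa [Nat.add_sub_cancel' h4.le] at this
      · rw [h3]
        refine Prod.ext ?_ ?_ <;> simp

end RotationArc

/-- Number of letters `true` before position `i`. -/
def onesBefore (w : ℕ → Bool) (i : ℕ) : ℤ :=
  ∑ k ∈ Finset.range i, if w k then 1 else 0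

theorem onesBefore_succ (w : ℕ → Bool) (i : ℕ) :
    onesBefore w (i + 1) = onesBefore w i + if w i then 1 else 0 :=
  Finset.sum_range_succ _ _

/-- Any two factors of the same length differ by at most one in their number of letters `true`. -/
def BalancedW (w : ℕ → Bool) : Prop :=
  ∀ i j k, onesBefore w (i + k) - onesBefore w i ≤ onesBefore w (j + k) - onesBefore w j + 1

section Words

variable {α : Type*} {w : ℕ → α}

@[simp] theorem length_wordAt (w : ℕ → α) (i n : ℕ) : (wordAt w i n).length = n := by
  simp [wordAt]

theorem wordAt_succ (w : ℕ → α) (i n : ℕ) : wordAt w i (n + 1) = wordAt w i n ++ [w (i + n)] := by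
  simp [wordAt, List.range_succ]

theorem wordAt_succ' (w : ℕ → α) (i n : ℕ) : wordAt w i (n + 1) = w i :: wordAt w (i + 1) n := by
  simp [wordAt, List.range_succ_eq_map, Function.comp_def, add_assoc, add_comm 1]

theorem wordAt_eq_wordAt_iff {i j n : ℕ} :
    wordAt w i n = wordAt w j n ↔ ∀ k < n, w (i + k) = w (j + k) := by
  simp [wordAt, List.map_inj_left]

theorem isFactorW_wordAt (w : ℕ → α) (i n : ℕ) : IsFactorW w (wordAt w i n) :=
  ⟨i, by simp⟩

theorem wordAt_eq_of_append {v : List α} {a : α} {i : ℕ}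
    (h : v ++ [a] = wordAt w i (v ++ [a]).length) :
    wordAt w i v.length = v ∧ w (i + v.length) = a := by
  rw [List.length_append, List.length_singleton, wordAt_succ] at h
  have := List.append_inj' h rfl
  exact ⟨this.1.symm, by simpa using this.2.symm⟩

theorem IsFactorW.exists_append {v : List α} (h : IsFactorW w v) :
    ∃ a, IsFactorW w (v ++ [a]) := by
  obtain ⟨i, hi⟩ := h
  refine ⟨w (i + v.length), i, ?_⟩
  rw [List.length_append, List.length_singleton, wordAt_succ, ← hi]

theorem IsFactorW.of_append {v : List α} {a : α} (h : IsFactorW w (v ++ [a])) : IsFactorW w v := by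
  obtain ⟨i, hi⟩ := h
  exact ⟨i, (wordAt_eq_of_append hi).1.symm⟩

end Words

theorem rightSpecial_wordAt {w : ℕ → Bool} {i j n : ℕ} (h : wordAt w i n = wordAt w j n)
    (hne : w (i + n) ≠ w (j + n)) : RightSpecial w (wordAt w i n) := by
  have hi : IsFactorW w (wordAt w i n ++ [w (i + n)]) := by
    rw [← wordAt_succ]; exact isFactorW_wordAt ..
  have hj : IsFactorW w (wordAt w i n ++ [w (j + n)]) := by
    rw [h, ← wordAt_succ]; exact isFactorW_wordAt ..
  cases h1 : w (i + n) <;> cases h2 : w (j + n) <;> simp_all [RightSpecial]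

theorem SturmianW.ncard_rightSpecial {w : ℕ → Bool} (hw : SturmianW w) (n : ℕ) :
    {v : List Bool | v.length = n ∧ RightSpecial w v}.ncard = 1 := by
  set F : ℕ → Set (List Bool) := fun m => {v | v.length = m ∧ IsFactorW w v} with hF
  have hcard : ∀ m, (F m).ncard = m + 1 := hw.2
  have hfin : ∀ m, (F m).Finite := fun m =>
    Set.finite_of_ncard_ne_zero (by rw [hcard]; omega)
  set A : Bool → Set (List Bool) := fun a => {v | v.length = n ∧ IsFactorW w (v ++ [a])} with hA
  have hAF : ∀ a, A a ⊆ F n := fun a v hv => ⟨hv.1, hv.2.of_append⟩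
  have hAfin : ∀ a, (A a).Finite := fun a => (hfin n).subset (hAF a)
  have hinter : A false ∩ A true = {v | v.length = n ∧ RightSpecial w v} := by
    ext v; simp only [hA, RightSpecial, Set.mem_inter_iff, Set.mem_ofPred_eq]; tauto
  have hunion : A false ∪ A true = F n := by
    refine Set.Subset.antisymm (Set.union_subset (hAF _) (hAF _)) fun v hv => ?_
    obtain ⟨a, ha⟩ := hv.2.exists_append
    cases a
    · exact Or.inl ⟨hv.1, ha⟩
    · exact Or.inr ⟨hv.1, ha⟩
  have hsucc : F (n + 1) = (fun v => v ++ [false]) '' A false ∪ (fun v => v ++ [true]) '' A true := by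
    ext v
    constructor
    · rintro ⟨hv, hf⟩
      obtain ⟨v', a, rfl⟩ := (List.eq_nil_or_concat' v).resolve_left (by rintro rfl; simp at hv)
      have hv' : v'.length = n := by simpa using hv
      cases a
      · exact Or.inl ⟨v', ⟨hv', hf⟩, rfl⟩
      · exact Or.inr ⟨v', ⟨hv', hf⟩, rfl⟩
    · rintro (⟨v', ⟨h1, h2⟩, rfl⟩ | ⟨v', ⟨h1, h2⟩, rfl⟩) <;> exact ⟨by simp [h1], h2⟩
  have hdisj : Disjoint ((fun v => v ++ [false]) '' A false) ((fun v => v ++ [true]) '' A true) := by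
    rw [Set.disjoint_left]
    rintro _ ⟨v, -, rfl⟩ ⟨v', -, h⟩
    simpa using (List.append_inj' h rfl).2
  have hinj : ∀ a : Bool, Function.Injective fun v : List Bool => v ++ [a] :=
    fun a => List.append_left_injective [a]
  have h1 := hcard (n + 1)
  rw [hsucc, Set.ncard_union_eq hdisj ((hAfin _).image _) ((hAfin _).image _),
    Set.ncard_image_of_injective _ (hinj _), Set.ncard_image_of_injective _ (hinj _)] at h1
  have h2 := Set.ncard_union_add_ncard_inter (A false) (A true) (hAfin _) (hAfin _)
  rw [hunion, hcard, hinter] at h2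
  omega

theorem SturmianW.rightSpecial_unique {w : ℕ → Bool} (hw : SturmianW w) {v v' : List Bool}
    (h : RightSpecial w v) (h' : RightSpecial w v') (hl : v.length = v'.length) : v = v' := by
  obtain ⟨z, hz⟩ := Set.ncard_eq_one.1 (hw.ncard_rightSpecial v.length)
  have h1 : v ∈ ({z} : Set (List Bool)) := hz ▸ ⟨rfl, h⟩
  have h2 : v' ∈ ({z} : Set (List Bool)) := hz ▸ ⟨hl.symm, h'⟩
  rw [Set.mem_singleton_iff] at h1 h2
  rw [h1, h2]

/-- Among any `m + 1` consecutive windows of length `m`, one is right special. -/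
theorem SturmianW.exists_rightSpecial_window {w : ℕ → Bool} (hw : SturmianW w) (m x : ℕ) :
    ∃ t ≤ m, RightSpecial w (wordAt w (x + t) m) := by
  by_contra! hcon
  obtain ⟨z, hz⟩ := Set.ncard_eq_one.1 (hw.ncard_rightSpecial m)
  set F : Set (List Bool) := {v | v.length = m ∧ IsFactorW w v} with hF
  have hcard : F.ncard = m + 1 := hw.2 m
  have hfin : F.Finite := Set.finite_of_ncard_ne_zero (by omega)
  have hzm : z.length = m ∧ RightSpecial w z := by
    have : z ∈ ({z} : Set (List Bool)) := rfl
    rwa [← hz] at this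
  have hlt : (F \ {z}).ncard < (Finset.range (m + 1) : Set ℕ).ncard := by
    rw [Set.ncard_sdiff_singleton_of_mem (show z ∈ F from ⟨hzm.1, hzm.2.1.of_append⟩), Set.ncard_coe_finset,
      Finset.card_range]
    omega
  obtain ⟨t, ht, t', ht', hne, heq⟩ := Set.exists_ne_map_eq_of_ncard_lt_of_maps_to hlt
    (f := fun t => wordAt w (x + t) m) (fun t ht => by
      have ht : t ≤ m := by simpa [Nat.lt_succ_iff] using ht
      refine ⟨⟨by simp, isFactorW_wordAt ..⟩, fun h => hcon t ht ?_⟩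
      rw [Set.mem_singleton_iff.1 h]
      exact hzm.2) (hfin.sdiff)
  simp only [Finset.coe_range, Set.mem_Iio] at ht ht' heq
  wlog hlt' : t < t' generalizing t t'
  · exact this t' t hne.symm heq.symm ht' ht (by omega)
  obtain ⟨P, rfl⟩ := Nat.exists_eq_add_of_lt hlt'
  have key : ∀ s, wordAt w (x + t + s) m = wordAt w (x + t + s + (P + 1)) m ∧
      ¬ RightSpecial w (wordAt w (x + t + s) m) := by
    intro s
    induction s using Nat.strong_induction_on with
    | _ s ih =>
      rcases Nat.eq_zero_or_pos s with rfl | hs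
      · exact ⟨by simpa [add_assoc] using heq, by simpa using hcon t (by omega)⟩
      obtain ⟨r, rfl⟩ := Nat.exists_eq_add_of_lt hs
      rw [zero_add] at *
      have hshift : wordAt w (x + t + (r + 1)) m = wordAt w (x + t + (r + 1) + (P + 1)) m := by
        obtain ⟨h1, h2⟩ := ih r (by omega)
        have hlast : w (x + t + r + m) = w (x + t + r + (P + 1) + m) := by
          by_contra hne
          exact h2 (rightSpecial_wordAt h1 hne)
        have := (wordAt_succ w (x + t + r) m).trans
          ((congrArg₂ (fun a b => a ++ [b]) h1 hlast).trans (wordAt_succ w _ m).symm)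
        rw [wordAt_succ', wordAt_succ', List.cons.injEq] at this
        convert this.2 using 2 <;> omega
      refine ⟨hshift, ?_⟩
      rcases le_or_gt (r + 1) (P + 1) with h | h
      · rw [add_assoc]
        exact hcon (t + (r + 1)) (by omega)
      · obtain ⟨h1, h2⟩ := ih (r + 1 - (P + 1)) (by omega)
        rw [h1] at h2
        convert h2 using 3
        omega
  refine hw.1 ⟨P + 1, by omega, x + t + m, fun l hl => ?_⟩
  obtain ⟨s, rfl⟩ := Nat.exists_eq_add_of_le hl
  obtain ⟨h1, h2⟩ := key s
  by_contra hne
  refine h2 (rightSpecial_wordAt h1 fun h => hne ?_)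
  convert h.symm using 2 <;> omega

theorem SturmianW.balanced {w : ℕ → Bool} (hw : SturmianW w) : BalancedW w := by
  classical
  by_contra hcon
  have hex : ∃ N, ∃ i j, onesBefore w (i + N) - onesBefore w i + 1 <
      onesBefore w (j + N) - onesBefore w j := by
    simp only [BalancedW, not_forall, not_le] at hcon
    obtain ⟨i, j, N, h⟩ := hcon
    exact ⟨N, j, i, h⟩
  obtain ⟨i, j, hij⟩ := Nat.find_spec hex
  have hbal : ∀ k < Nat.find hex, ∀ x y, onesBefore w (y + k) - onesBefore w y ≤
      onesBefore w (x + k) - onesBefore w x + 1 := by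
    intro k hk x y
    have := Nat.find_min hex hk
    push Not at this
    exact this x y
  generalize Nat.find hex = N at *
  have hN : 2 ≤ N := by
    by_contra! hlt
    interval_cases N
    · simp at hij
    · rw [onesBefore_succ, onesBefore_succ] at hij
      split_ifs at hij <;> omega
  obtain ⟨n, rfl⟩ := Nat.exists_eq_add_of_le' hN
  have pre : ∀ k, 0 < k → k < n + 2 →
      onesBefore w (j + k) - onesBefore w j = onesBefore w (i + k) - onesBefore w i + 1 := by
    intro k hk hk'
    have h1 := hbal k hk' i j
    have h2 := hbal (n + 2 - k) (by omega) (i + k) (j + k)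
    rw [add_assoc, add_assoc, Nat.add_sub_cancel' hk'.le] at h2
    omega
  have htot : onesBefore w (j + (n + 2)) - onesBefore w j =
      onesBefore w (i + (n + 2)) - onesBefore w i + 2 := by
    have h1 := pre (n + 1) (by omega) (by omega)
    have h2 := hbal 1 (by omega) (i + (n + 1)) (j + (n + 1))
    simp only [add_assoc] at h2
    norm_num at h2
    omega
  have pal : ∀ k < n + 3, onesBefore w (i + k) - onesBefore w i =
      onesBefore w (i + (n + 2)) - onesBefore w (i + (n + 2 - k)) := by
    intro k hk
    rcases Nat.eq_zero_or_pos k with rfl | hk0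
    · simp
    rcases (Nat.lt_succ_iff.1 hk).eq_or_lt with rfl | hk'
    · simp
    have h1 := pre k hk0 hk'
    have h2 := pre (n + 2 - k) (by omega) (by omega)
    have h3 := hbal k hk' (i + (n + 2 - k)) j
    have h4 := hbal k hk' i (j + (n + 2 - k))
    have e1 : i + (n + 2 - k) + k = i + (n + 2) := by omega
    have e2 : j + (n + 2 - k) + k = j + (n + 2) := by omega
    rw [e1] at h3
    rw [e2] at h4
    omega
  have pal_i : ∀ k < n + 2, w (i + k) = w (i + (n + 1 - k)) := by
    intro k hk
    have h1 := pal k (by omega)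
    have h2 := pal (k + 1) (by omega)
    have e : i + (n + 2 - k) = i + (n + 1 - k) + 1 := by omega
    have e' : i + (n + 2 - (k + 1)) = i + (n + 1 - k) := by omega
    rw [e', ← add_assoc, onesBefore_succ] at h2
    rw [e, onesBefore_succ] at h1
    cases h3 : w (i + k) <;> cases h4 : w (i + (n + 1 - k)) <;> simp [h3, h4] at h1 h2 ⊢ <;> omega
  have first : w i = false ∧ w j = true := by
    have h1 := pre 1 (by omega) (by omega)
    rw [onesBefore_succ, onesBefore_succ] at h1
    cases h3 : w i <;> cases h4 : w j <;> simp [h3, h4] at h1 ⊢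
  have last : w (i + (n + 1)) = false ∧ w (j + (n + 1)) = true := by
    have h1 := pre (n + 1) (by omega) (by omega)
    have h2 := htot
    rw [show i + (n + 2) = i + (n + 1) + 1 by omega, show j + (n + 2) = j + (n + 1) + 1 by omega,
      onesBefore_succ, onesBefore_succ] at h2
    cases h3 : w (i + (n + 1)) <;> cases h4 : w (j + (n + 1)) <;> simp [h3, h4] at h2 ⊢ <;> omega
  have middle : ∀ k < n, w (i + 1 + k) = w (j + 1 + k) := by
    intro k hk
    have h1 := pre (k + 1) (by omega) (by omega)
    have h2 := pre (k + 2) (by omega) (by omega)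
    rw [show i + (k + 2) = i + (k + 1) + 1 by omega, show j + (k + 2) = j + (k + 1) + 1 by omega,
      onesBefore_succ, onesBefore_succ] at h2
    rw [show i + 1 + k = i + (k + 1) by omega, show j + 1 + k = j + (k + 1) by omega]
    cases h3 : w (i + (k + 1)) <;> cases h4 : w (j + (k + 1)) <;> simp [h3, h4] at h2 ⊢ <;> omega
  have hmid : wordAt w (i + 1) n = wordAt w (j + 1) n := wordAt_eq_wordAt_iff.2 middle
  have hp : RightSpecial w (wordAt w (i + 1) n) := by
    refine rightSpecial_wordAt hmid ?_
    rw [show i + 1 + n = i + (n + 1) by omega, show j + 1 + n = j + (n + 1) by omega, last.1,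
      last.2]
    simp
  /- the palindrome `e :: p ++ [e]` at `x`, where `e :: p` is not right special -/
  have main : ∀ x : ℕ, wordAt w (x + 1) n = wordAt w (i + 1) n → w (x + (n + 1)) = w x →
      RightSpecial w (w x :: wordAt w (i + 1) n) := by
    intro x hx hlast
    obtain ⟨t, ht, hrs⟩ := hw.exists_rightSpecial_window (n + 1) x
    rw [wordAt_succ'] at hrs
    have hsuf : RightSpecial w (wordAt w (x + t + 1) n) := by
      have : ∀ a, IsFactorW w (w (x + t) :: wordAt w (x + t + 1) n ++ [a]) →
          IsFactorW w (wordAt w (x + t + 1) n ++ [a]) := by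
        rintro a ⟨s, hs⟩
        refine ⟨s + 1, ?_⟩
        simp only [List.cons_append, List.length_cons] at hs
        rw [wordAt_succ', List.cons.injEq] at hs
        exact hs.2
      exact ⟨this _ hrs.1, this _ hrs.2⟩
    have heq := hw.rightSpecial_unique hsuf hp (by simp)
    rw [heq] at hrs
    suffices w (x + t) = w x by rwa [this] at hrs
    rcases Nat.eq_zero_or_pos t with rfl | ht0
    · simp
    rcases ht.eq_or_lt with rfl | ht1
    · exact hlast
    rw [wordAt_eq_wordAt_iff] at heq hx
    have h1 := heq (n - t) (by omega)
    have h2 := hx (t - 1) (by omega)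
    have h3 := pal_i t (by omega)
    rw [show x + t + 1 + (n - t) = x + (n + 1) by omega,
      show i + 1 + (n - t) = i + (n + 1 - t) by omega] at h1
    rw [show x + 1 + (t - 1) = x + t by omega, show i + 1 + (t - 1) = i + t by omega] at h2
    rw [h2, h3, ← h1, hlast]
  have hi := main i rfl (by rw [last.1, first.1])
  have hj := main j hmid.symm (by rw [last.2, first.2])
  have := hw.rightSpecial_unique hi hj (by simp)
  rw [first.1, first.2] at this
  simp at this

theorem BalancedW.exists_slope {w : ℕ → Bool} (hw : BalancedW w) :
    ∃ α : ℝ, ∀ i n : ℕ, |(onesBefore w (i + n) - onesBefore w i : ℝ) - n * α| ≤ 1 := by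
  have block : ∀ i j n k : ℕ,
      (k : ℤ) * (onesBefore w (j + n) - onesBefore w j - 1) ≤
        onesBefore w (i + k * n) - onesBefore w i ∧
      onesBefore w (i + k * n) - onesBefore w i ≤
        (k : ℤ) * (onesBefore w (j + n) - onesBefore w j + 1) := by
    intro i j n k
    induction k with
    | zero => simp
    | succ k ih =>
      have h1 := hw j (i + k * n) n
      have h2 := hw (i + k * n) j n
      rw [show i + (k + 1) * n = i + k * n + n by ring]
      push_cast
      constructor <;> linarith [ih.1, ih.2]
  have cross : ∀ i j n k : ℕ, 0 < n → 0 < k →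
      ((onesBefore w (i + n) - onesBefore w i - 1 : ℝ)) / n ≤
        ((onesBefore w (j + k) - onesBefore w j + 1 : ℝ)) / k := by
    intro i j n k hn hk
    have h1 := (block 0 i n k).1
    have h2 := (block 0 j k n).2
    rw [mul_comm k n] at h1
    have h3 : ((k : ℤ) * (onesBefore w (i + n) - onesBefore w i - 1) : ℝ) ≤
        (n : ℤ) * (onesBefore w (j + k) - onesBefore w j + 1) := by exact_mod_cast h1.trans h2
    rw [div_le_div_iff₀ (by positivity) (by positivity)]
    push_cast at h3
    linarith
  set A : Set ℝ := {x | ∃ i n : ℕ, 0 < n ∧ x = (onesBefore w (i + n) - onesBefore w i - 1 : ℝ) / n}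
  have hne : A.Nonempty := ⟨_, 0, 1, one_pos, rfl⟩
  have hbdd : BddAbove A := ⟨_, by rintro _ ⟨i, n, hn, rfl⟩; exact cross i 0 n 1 hn one_pos⟩
  refine ⟨sSup A, fun i n => ?_⟩
  rcases Nat.eq_zero_or_pos n with rfl | hn
  · simp
  have h1 : (onesBefore w (i + n) - onesBefore w i - 1 : ℝ) / n ≤ sSup A :=
    le_csSup hbdd ⟨i, n, hn, rfl⟩
  have h2 : sSup A ≤ (onesBefore w (i + n) - onesBefore w i + 1 : ℝ) / n :=
    csSup_le hne (by rintro _ ⟨j, k, hk, rfl⟩; exact cross j i k n hk hn)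
  have hn' : (0 : ℝ) < n := by exact_mod_cast hn
  rw [div_le_iff₀ hn'] at h1
  rw [le_div_iff₀ hn'] at h2
  rw [abs_le]
  constructor <;> linarith

/-- A sequence with oscillation at most one whose `Q`-step increments are `0` or `1` is eventually
`Q`-periodic. -/
theorem eventually_periodic_of_increments {θ : ℕ → ℝ} {Q : ℕ} (hQ : 0 < Q)
    (hosc : ∀ i j, θ j - θ i ≤ 1) (hinc : ∀ i, θ (i + Q) = θ i ∨ θ (i + Q) = θ i + 1) :
    ∃ N, ∀ i, N ≤ i → θ (i + Q) = θ i := by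
  by_contra! hcon
  have hmono : ∀ i k, θ i ≤ θ (i + k * Q) := by
    intro i k
    induction k with
    | zero => simp
    | succ k ih =>
      rw [show i + (k + 1) * Q = i + k * Q + Q by ring]
      rcases hinc (i + k * Q) with h | h <;> linarith
  have hinf : {i | θ (i + Q) = θ i + 1}.Infinite := by
    refine Set.infinite_of_not_bddAbove ?_
    rintro ⟨b, hb⟩
    obtain ⟨i, hi, hne⟩ := hcon (b + 1)
    have := hb ((hinc i).resolve_left hne)
    omega
  obtain ⟨i, hi, j, hj, hlt, heq⟩ := hinf.exists_lt_map_eq_of_mapsTo (f := fun i => i % Q)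
    (t := Set.Iio Q) (fun i _ => Nat.mod_lt i hQ) (Set.finite_Iio Q)
  obtain ⟨k, hk⟩ := (Nat.modEq_iff_dvd' hlt.le).1 heq
  have hk0 : k ≠ 0 := by
    rintro rfl
    omega
  obtain ⟨l, rfl⟩ := Nat.exists_eq_succ_of_ne_zero hk0
  have hj' : j = i + Q + l * Q := by
    rw [Nat.succ_eq_add_one] at hk
    have : j = i + Q * (l + 1) := by omega
    rw [this]; ring
  have h1 := hmono (i + Q) l
  rw [← hj'] at h1
  have h2 : θ (i + Q) = θ i + 1 := hi
  have h3 : θ (j + Q) = θ j + 1 := hj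
  linarith [hosc i (j + Q)]

theorem BalancedW.irrational_slope {w : ℕ → Bool} (hw : BalancedW w) (hap : ¬ UltPeriodicW w)
    {α : ℝ} (hα : ∀ i n : ℕ, |(onesBefore w (i + n) - onesBefore w i : ℝ) - n * α| ≤ 1) :
    Irrational α := by
  rintro ⟨r, hr⟩
  set Q := r.den
  set P := r.num
  have hQ : 0 < Q := r.den_pos
  have hP : (Q : ℝ) * α = P := by
    rw [← hr]
    exact_mod_cast Rat.den_mul_eq_num r
  set θ : ℕ → ℝ := fun i => onesBefore w i - i * α with hθ
  have hosc : ∀ i j, |θ j - θ i| ≤ 1 := by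
    intro i j
    wlog hij : i ≤ j generalizing i j
    · rw [abs_sub_comm]; exact this j i (by omega)
    obtain ⟨k, rfl⟩ := Nat.exists_eq_add_of_le hij
    convert hα i k using 2
    simp only [hθ]; push_cast; ring
  have hE : ∀ i, θ (i + Q) - θ i = (onesBefore w (i + Q) - onesBefore w i - P : ℤ) := by
    intro i
    simp only [hθ]; push_cast; linarith
  have hbound : ∀ i, -1 ≤ onesBefore w (i + Q) - onesBefore w i - P ∧
      onesBefore w (i + Q) - onesBefore w i - P ≤ 1 := by
    intro i
    have := abs_le.1 (hosc i (i + Q))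
    rw [hE] at this
    exact_mod_cast this
  obtain ⟨N, hN⟩ : ∃ N, ∀ i, N ≤ i → θ (i + Q) = θ i := by
    by_cases hneg : ∃ i, onesBefore w (i + Q) - onesBefore w i - P = -1
    · obtain ⟨i₀, hi₀⟩ := hneg
      obtain ⟨N, hN⟩ := eventually_periodic_of_increments (θ := fun i => -θ i) hQ
        (fun i j => by linarith [(abs_le.1 (hosc i j)).1]) (fun i => by
          have h1 := hw i i₀ Q
          have h2 := hbound i
          have h3 := hE i
          have : onesBefore w (i + Q) - onesBefore w i - P = 0 ∨
            onesBefore w (i + Q) - onesBefore w i - P = -1 := by omega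
          rcases this with h | h <;> rw [h] at h3 <;> push_cast at h3
          · left; linarith
          · right; linarith)
      exact ⟨N, fun i hi => by linarith [hN i hi]⟩
    · refine eventually_periodic_of_increments hQ
        (fun i j => (abs_le.1 (hosc i j)).2) (fun i => ?_)
      have h2 := hbound i
      have h3 := hE i
      have : onesBefore w (i + Q) - onesBefore w i - P = 0 ∨
          onesBefore w (i + Q) - onesBefore w i - P = 1 := by
        have : onesBefore w (i + Q) - onesBefore w i - P ≠ -1 := fun h => hneg ⟨i, h⟩
        omega
      rcases this with h | h <;> rw [h] at h3 <;> push_cast at h3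
      · left; linarith
      · right; linarith
  refine hap ⟨Q, hQ, N, fun i hi => ?_⟩
  have h1 := hE i
  have h2 := hE (i + 1)
  rw [hN i hi, sub_self, eq_comm, Int.cast_eq_zero] at h1
  rw [hN (i + 1) (by omega), sub_self, eq_comm, Int.cast_eq_zero] at h2
  rw [add_right_comm, onesBefore_succ, onesBefore_succ] at h2
  cases h3 : w (i + Q) <;> cases h4 : w i <;> simp [h3, h4] at h2 ⊢ <;> omega

theorem count_true_wordAt (w : ℕ → Bool) (i n : ℕ) :
    ((wordAt w i n).count true : ℤ) = onesBefore w (i + n) - onesBefore w i := by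
  induction n with
  | zero => simp [wordAt]
  | succ n ih =>
    rw [wordAt_succ, List.count_append, ← add_assoc, onesBefore_succ]
    cases h : w (i + n) <;> simp [ih]
    ring

theorem abEquiv_iff {u v : List Bool} :
    AbEquiv u v ↔ u.length = v.length ∧ u.count true = v.count true := by
  have hu := List.count_true_add_count_false u
  have hv := List.count_true_add_count_false v
  rw [AbEquiv, Bool.forall_bool]
  omega

theorem exactlyKAbReturns_two_iff {α β : Type*} [DecidableEq α] {w : ℕ → α} {u : List α}
    {Φ : List α → β} (hΦ : ∀ r s, Φ r = Φ s ↔ AbEquiv r s) :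
    ExactlyKAbReturns w u 2 ↔ ∃ x y, x ≠ y ∧ Φ '' semiAbReturns w u = {x, y} := by
  constructor
  · rintro ⟨f, hf, h1, h2⟩
    refine ⟨Φ (f 0), Φ (f 1), fun h => by simpa using hf 0 1 ((hΦ _ _).1 h), ?_⟩
    ext z
    constructor
    · rintro ⟨r, hr, rfl⟩
      obtain ⟨i, hi⟩ := h1 r hr
      rw [(hΦ _ _).2 hi]
      fin_cases i <;> simp
    · rintro (rfl | rfl)
      · obtain ⟨r, hr, h⟩ := h2 0
        exact ⟨r, hr, (hΦ _ _).2 h⟩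
      · obtain ⟨r, hr, h⟩ := h2 1
        exact ⟨r, hr, (hΦ _ _).2 h⟩
  · rintro ⟨x, y, hxy, h⟩
    obtain ⟨r, hr, rfl⟩ : x ∈ Φ '' semiAbReturns w u := h ▸ Or.inl rfl
    obtain ⟨s, hs, rfl⟩ : y ∈ Φ '' semiAbReturns w u := h ▸ Or.inr rfl
    refine ⟨![r, s], ?_, fun t ht => ?_, ?_⟩
    · intro i j hij
      rw [← hΦ] at hij
      fin_cases i <;> fin_cases j
      exacts [rfl, (hxy hij).elim, (hxy hij.symm).elim, rfl]
    · have : Φ t ∈ Φ '' semiAbReturns w u := ⟨t, ht, rfl⟩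
      rw [h] at this
      rcases this with h | h
      · exact ⟨0, (hΦ _ _).1 h⟩
      · exact ⟨1, (hΦ _ _).1 h⟩
    · intro i
      fin_cases i
      · exact ⟨r, hr, (hΦ _ _).1 rfl⟩
      · exact ⟨s, hs, (hΦ _ _).1 rfl⟩

theorem exactlyTwoAbReturns_iff_singular {w : ℕ → Bool} {u : List Bool} (hu : IsFactorW w u)
    {θ : ℕ → ℝ} {α σ ρ L β : ℝ} (hσ : σ ≠ 0)
    (hθ : ∀ i, θ i = σ * (onesBefore w i - i * α))
    (h : RotationArc θ β ρ L u.length (abOcc w u)) :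
    ExactlyKAbReturns w u 2 ↔ ∀ v, IsFactorW w v → AbEquiv v u → v = u := by
  set Φ : List Bool → ℕ × ℝ := fun r => (r.length, σ * (r.count true - r.length * α)) with hΦdef
  have hΦ : ∀ r s, Φ r = Φ s ↔ AbEquiv r s := by
    intro r s
    rw [abEquiv_iff, Prod.mk.injEq]
    refine and_congr_right fun hl => ?_
    rw [hl, mul_right_inj' hσ, sub_left_inj, Nat.cast_inj]
  have hcount : ∀ i k, θ (i + k) - θ i = σ * ((wordAt w i k).count true - k * α) := by
    intro i k
    have : ((wordAt w i k).count true : ℝ) = onesBefore w (i + k) - onesBefore w i := by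
      exact_mod_cast count_true_wordAt w i k
    rw [this, hθ, hθ]; push_cast; ring
  have himage : Φ '' semiAbReturns w u = firstReturns θ (abOcc w u) := by
    have hval : ∀ i j, i < j → Φ (wordAt w i (j - i)) = (j - i, θ j - θ i) := by
      intro i j hij
      have := hcount i (j - i)
      rw [Nat.add_sub_cancel' hij.le] at this
      simp only [hΦdef, length_wordAt, this]
    ext z
    constructor
    · rintro ⟨_, ⟨i, j, hi, hj, hij, hmin, rfl⟩, rfl⟩
      exact ⟨i, j, hi, hj, hij, hmin, hval i j hij⟩
    · rintro ⟨i, j, hi, hj, hij, hmin, rfl⟩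
      exact ⟨_, ⟨i, j, hi, hj, hij, hmin, rfl⟩, hval i j hij⟩
  have hrigid : RotationArc.Rigid θ u.length (abOcc w u) ↔
      ∀ v, IsFactorW w v → AbEquiv v u → v = u := by
    constructor
    · rintro hR v ⟨i, hi⟩ hv
      obtain ⟨j, hj⟩ := hu
      have hl := (abEquiv_iff.1 hv).1
      rw [hl] at hi
      have hiX : i ∈ abOcc w u := by rw [abOcc, Set.mem_ofPred_eq, ← hi]; exact hv
      have hjX : j ∈ abOcc w u := by rw [abOcc, Set.mem_ofPred_eq, ← hj]; exact fun _ => rfl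
      have heq : ∀ k ≤ u.length, onesBefore w (i + k) - onesBefore w i =
          onesBefore w (j + k) - onesBefore w j := by
        intro k hk
        rw [← count_true_wordAt, ← count_true_wordAt, Nat.cast_inj]
        rcases hk.eq_or_lt with rfl | hk
        · exact (hiX true).trans (hjX true).symm
        · have := hR i hiX j hjX k hk
          rw [hcount, hcount, mul_right_inj' hσ, sub_left_inj, Nat.cast_inj] at this
          exact this
      rw [hi, hj, length_wordAt, wordAt_eq_wordAt_iff]
      intro k hk
      have h1 := heq k hk.le
      have h2 := heq (k + 1) hk
      rw [← add_assoc, ← add_assoc, onesBefore_succ, onesBefore_succ] at h2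
      cases h3 : w (i + k) <;> cases h4 : w (j + k) <;> simp [h3, h4] at h2 ⊢ <;> omega
    · intro hs i hi j hj k hk
      have h1 := (hs _ (isFactorW_wordAt ..) hi).trans (hs _ (isFactorW_wordAt ..) hj).symm
      rw [wordAt_eq_wordAt_iff] at h1
      rw [hcount, hcount, wordAt_eq_wordAt_iff.2 fun l hl => h1 l (hl.trans hk)]
  rw [exactlyKAbReturns_two_iff hΦ, himage, ← hrigid]
  exact ⟨fun ⟨_, _, _, hxy⟩ => h.rigid_of_two_firstReturns hxy, h.two_firstReturns_of_rigid⟩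

/-- A factor of a Sturmian word has exactly two abelian returns iff it is singular,
i.e. the unique factor in its abelian class. -/
theorem stmt9 (w : ℕ → Bool) (hst : SturmianW w) (u : List Bool)
    (hu : IsFactorW w u) (hne : u ≠ []) :
    ExactlyKAbReturns w u 2 ↔ (∀ v, IsFactorW w v → AbEquiv v u → v = u) := by
  obtain ⟨α, hα⟩ := hst.balanced.exists_slope
  have hirr := hst.balanced.irrational_slope hst.1 hα
  have hn : 0 < u.length := List.length_pos_iff.2 hne
  generalize hlen : u.length = n at hn
  set θ : ℕ → ℝ := fun i => onesBefore w i - i * α with hθ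
  have hstep : ∀ i k : ℕ, θ (i + k) =
      θ i + ((onesBefore w (i + k) - onesBefore w i : ℤ) - k * α) := by
    intro i k
    simp only [hθ]; push_cast; ring
  have hosc : ∀ i j, θ j ≤ θ i + 1 := by
    intro i j
    rcases le_total i j with hij | hij <;> obtain ⟨k, rfl⟩ := Nat.exists_eq_add_of_le hij
    · have := abs_le.1 (hα i k)
      rw [hstep]; push_cast; linarith
    · have := abs_le.1 (hα j k)
      rw [hstep]; push_cast; linarith
  set ρ : ℝ := ⨅ i, θ i with hρ
  have hbdd : BddBelow (Set.range θ) :=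
    ⟨θ 0 - 1, by rintro _ ⟨i, rfl⟩; linarith [hosc i 0]⟩
  have hlow : ∀ i, ρ ≤ θ i := fun i => ciInf_le hbdd i
  have hupp : ∀ i, θ i ≤ ρ + 1 := fun i => by
    linarith [le_ciInf fun j => (by linarith [hosc j i] : θ i - 1 ≤ θ j)]
  set m : ℤ := ⌊(n : ℝ) * α⌋ with hm
  have hm1 : (m : ℝ) < n * α := lt_of_le_of_ne (Int.floor_le _)
    ((hirr.natCast_mul hn.ne').ne_int m).symm
  have hm2 : (n : ℝ) * α < m + 1 := Int.lt_floor_add_one _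
  have hval : ∀ i, onesBefore w (i + n) - onesBefore w i = m ∨
      onesBefore w (i + n) - onesBefore w i = m + 1 := by
    intro i
    have h1 := abs_le.1 (hα i n)
    have h2 : (m : ℝ) - 1 < (onesBefore w (i + n) - onesBefore w i : ℤ) := by
      push_cast; linarith
    have h3 : ((onesBefore w (i + n) - onesBefore w i : ℤ) : ℝ) < m + 2 := by
      push_cast; linarith
    have h2 : m - 1 < onesBefore w (i + n) - onesBefore w i := by exact_mod_cast h2
    have h3 : onesBefore w (i + n) - onesBefore w i < m + 2 := by exact_mod_cast h3
    omega
  have hocc : ∀ i, i ∈ abOcc w u ↔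
      onesBefore w (i + n) - onesBefore w i = (u.count true : ℤ) := by
    intro i
    rw [abOcc, Set.mem_ofPred_eq, abEquiv_iff, length_wordAt, ← count_true_wordAt, hlen]
    simp
  obtain ⟨j, hj⟩ := hu
  have hcu := hval j
  rw [← count_true_wordAt, ← hlen, ← hj] at hcu
  rcases hcu with hc | hc
  · refine exactlyTwoAbReturns_iff_singular ⟨j, hj⟩ (θ := fun i => -θ i) (σ := -1) (α := α)
      (β := -α) (ρ := -ρ - 1) (L := m + 1 - n * α) (by norm_num)
      (fun i => by simp only [hθ]; ring) ?_
    rw [hlen]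
    refine ⟨hirr.neg, fun i => by linarith [hupp i], fun i => by linarith [hlow i], fun i k => ?_,
      by linarith, by linarith, ⟨-m - 1, by push_cast; ring⟩, fun i hi => ?_, fun i hi => ?_⟩
    · refine ⟨-(onesBefore w (i + k) - onesBefore w i), ?_⟩
      rw [hstep]; push_cast; ring
    · rw [hocc, hc] at hi
      rw [hstep, hi]; ring
    · rw [hocc, hc] at hi
      rw [hstep, (hval i).resolve_left hi]; push_cast; ring
  · refine exactlyTwoAbReturns_iff_singular ⟨j, hj⟩ (θ := θ) (σ := 1) (α := α)
      (β := α) (ρ := ρ) (L := n * α - m) one_ne_zero (fun i => by simp only [hθ]; ring) ?_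
    rw [hlen]
    refine ⟨hirr, hlow, hupp, fun i k => ⟨_, hstep i k⟩,
      by linarith, by linarith, ⟨m, rfl⟩, fun i hi => ?_, fun i hi => ?_⟩
    · rw [hocc, hc] at hi
      rw [hstep, hi]; push_cast; ring
    · rw [hocc, hc] at hi
      rw [hstep, (hval i).resolve_right hi]; ring
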